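/- arXiv:2104.09706 — 2 statements merged into one kernel-verified Lean document; each statement's English description precedes it below -/
import Mathlib

section
/- Let G be a finite connected graph and a, b vertices. Then E_a T_b + E_b T_a = 2|E| R_{ab}, where E_a T_b is the expected hitting time of b by simple random walk started at a, |E| is the number of edges, and R_{ab} is the effective resistance between a and b with unit edge resistances. -/
open Finset

section Defs

variable {V : Type*} [Fintype V]

/-- Total conductance at a vertex. -/
noncomputable def condAt (c : V → V → ℝ) (x : V) : ℝ := ∑ y, c x y

/-- Transition probabilities of the random walk induced by conductances `c`. -/
noncomputable def step (c : V → V → ℝ) (x y : V) : ℝ := c x y / condAt c x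

open scoped Classical in
/-- `surv P b n a` is the probability that the walk with transition matrix `P`
started at `a` has not visited `b` by time `n`. -/
noncomputable def surv (P : V → V → ℝ) (b : V) : ℕ → V → ℝ
  | 0 => fun a => if a = b then 0 else 1
  | n + 1 => fun a => if a = b then 0 else ∑ y, P a y * surv P b n y

/-- Expected hitting time of `b` starting from `a`, as the sum over `n` of the
survival probabilities `P(T_b > n)`. -/
noncomputable def hitTime (P : V → V → ℝ) (a b : V) : ℝ := ∑' n, surv P b n a

/-- Expected return time to `z` : one step plus the expected hitting time of `z`
from the position after the first step. -/
noncomputable def returnTime (P : V → V → ℝ) (z : V) : ℝ :=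
  1 + ∑ y, P z y * hitTime P y z

/-- Dirichlet energy of a potential `f` for conductances `c`. -/
noncomputable def energy (c : V → V → ℝ) (f : V → ℝ) : ℝ :=
  (1 / 2) * ∑ x, ∑ y, c x y * (f x - f y) ^ 2

/-- Effective resistance between `a` and `b` (Dirichlet principle): the
reciprocal of the minimal Dirichlet energy among potentials with
`f a = 1`, `f b = 0`. -/
noncomputable def effRes (c : V → V → ℝ) (a b : V) : ℝ :=
  1 / sInf {E : ℝ | ∃ f : V → ℝ, f a = 1 ∧ f b = 0 ∧ E = energy c f}

end Defs

open scoped Classical in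
/-- Unit conductances on the edges of a simple graph. -/
noncomputable def gw {V : Type*} (G : SimpleGraph V) (x y : V) : ℝ :=
  if G.Adj x y then 1 else 0

/-- Number of edges of a simple graph. -/
noncomputable def numEdges {V : Type*} (G : SimpleGraph V) : ℕ := G.edgeSet.ncard


section Aux

variable {V : Type*} [Fintype V]

lemma gw_symm (G : SimpleGraph V) (x y : V) : gw G x y = gw G y x := by
  unfold gw; rw [G.adj_comm x y]

lemma gw_nonneg (G : SimpleGraph V) (x y : V) : 0 ≤ gw G x y := by
  unfold gw; split_ifs <;> norm_num

/-- Laplacian pairing. -/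
lemma lap_pair (c : V → V → ℝ) (hc : ∀ x y, c x y = c y x) (p f : V → ℝ) :
    ∑ x, ∑ y, c x y * (p x - p y) * (f x - f y)
      = 2 * ∑ x, f x * ∑ y, c x y * (p x - p y) := by
  have h1 : ∑ x, ∑ y, c x y * (p x - p y) * (f x - f y)
      = ∑ x, ∑ y, f x * (c x y * (p x - p y)) + ∑ x, ∑ y, f y * (c y x * (p y - p x)) := by
    rw [← Finset.sum_add_distrib]
    refine Finset.sum_congr rfl fun x _ => ?_
    rw [← Finset.sum_add_distrib]
    refine Finset.sum_congr rfl fun y _ => ?_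
    rw [hc y x]; ring
  rw [h1, Finset.sum_comm (f := fun x y => f y * (c y x * (p y - p x)))]
  simp only [Finset.mul_sum]
  simp only [two_mul, Finset.sum_add_distrib]

lemma energy_add (c : V → V → ℝ) (hc : ∀ x y, c x y = c y x) (g d : V → ℝ) :
    energy c (fun x => g x + d x) = energy c g + energy c d
      + 2 * ∑ x, d x * ∑ y, c x y * (g x - g y) := by
  rw [← lap_pair c hc]
  unfold energy
  simp only [Finset.mul_sum, ← Finset.sum_add_distrib]
  refine Finset.sum_congr rfl fun x _ => Finset.sum_congr rfl fun y _ => ?_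
  ring

lemma energy_eq (c : V → V → ℝ) (hc : ∀ x y, c x y = c y x) (g : V → ℝ) :
    energy c g = ∑ x, g x * ∑ y, c x y * (g x - g y) := by
  have := lap_pair c hc g g
  unfold energy
  have h2 : ∑ x, ∑ y, c x y * (g x - g y) ^ 2
      = ∑ x, ∑ y, c x y * (g x - g y) * (g x - g y) :=
    Finset.sum_congr rfl fun x _ => Finset.sum_congr rfl fun y _ => by ring
  rw [h2, this]; ring

lemma energy_nonneg' (c : V → V → ℝ) (hc : ∀ x y, 0 ≤ c x y) (g : V → ℝ) :
    0 ≤ energy c g := by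
  unfold energy
  have : 0 ≤ ∑ x, ∑ y, c x y * (g x - g y) ^ 2 :=
    Finset.sum_nonneg fun x _ => Finset.sum_nonneg fun y _ => mul_nonneg (hc x y) (sq_nonneg _)
  linarith

lemma surv_nonneg (P : V → V → ℝ) (hP : ∀ x y, 0 ≤ P x y) (b : V) (n : ℕ) (x : V) :
    0 ≤ surv P b n x := by
  induction n generalizing x with
  | zero => simp only [surv]; split_ifs <;> norm_num
  | succ n ih =>
    simp only [surv]; split_ifs
    · exact le_rfl
    · exact Finset.sum_nonneg fun y _ => mul_nonneg (hP x y) (ih y)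

lemma surv_self (P : V → V → ℝ) (b : V) (n : ℕ) : surv P b n b = 0 := by
  cases n <;> simp [surv]

lemma surv_partial (P : V → V → ℝ) (hP : ∀ x y, 0 ≤ P x y) (b : V) (h : V → ℝ)
    (h0 : ∀ x, 0 ≤ h x) (hL : ∀ x, x ≠ b → 1 + ∑ y, P x y * h y ≤ h x) (n : ℕ) (x : V) :
    ∑ i ∈ range n, surv P b i x ≤ h x := by
  induction n generalizing x with
  | zero => simpa using h0 x
  | succ n ih =>
    by_cases hx : x = b
    · subst hx; simpa [surv_self] using h0 x
    · rw [Finset.sum_range_succ']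
      simp only [surv, hx, if_false]
      rw [Finset.sum_comm]
      refine le_trans ?_ (hL x hx)
      rw [add_comm]
      gcongr with y
      rw [← Finset.mul_sum]
      exact mul_le_mul_of_nonneg_left (ih y) (hP x y)

lemma condAt_pos (G : SimpleGraph V) (x y : V) (h : G.Adj x y) : 0 < condAt (gw G) x := by
  unfold condAt
  refine lt_of_lt_of_le ?_
    (Finset.single_le_sum (f := fun y => gw G x y) (fun i _ => gw_nonneg G x i) (mem_univ y))
  simp [gw, h]

lemma condAt_le (G : SimpleGraph V) (x : V) : condAt (gw G) x ≤ Fintype.card V := by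
  unfold condAt
  calc ∑ y, gw G x y ≤ ∑ _y : V, (1 : ℝ) := by
        refine Finset.sum_le_sum fun y _ => ?_
        unfold gw; split_ifs <;> norm_num
    _ = _ := by simp

lemma exists_nbr (G : SimpleGraph V) (hconn : G.Connected) (x b : V) (h : x ≠ b) :
    ∃ y, G.Adj x y ∧ G.dist x b = G.dist y b + 1 := by
  obtain ⟨w, hw⟩ := hconn.exists_walk_length_eq_dist x b
  cases w with
  | nil => exact absurd rfl h
  | cons hadj p =>
    rename_i y
    refine ⟨y, hadj, ?_⟩
    have h1 := SimpleGraph.dist_le p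
    have h2 := hconn.dist_triangle (u := x) (v := y) (w := b)
    have h3 : G.dist x y = 1 := SimpleGraph.dist_eq_one_iff_adj.mpr hadj
    simp at hw
    omega

lemma step_nonneg (G : SimpleGraph V) (x y : V) : 0 ≤ step (gw G) x y := by
  unfold step condAt
  exact div_nonneg (gw_nonneg G x y) (Finset.sum_nonneg fun i _ => gw_nonneg G x i)

lemma step_sum (G : SimpleGraph V) (x : V) (h : 0 < condAt (gw G) x) :
    ∑ y, step (gw G) x y = 1 := by
  unfold step
  rw [← Finset.sum_div]
  exact div_self h.ne'

lemma exists_lyap (G : SimpleGraph V) (hconn : G.Connected) (b : V) :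
    ∃ h : V → ℝ, (∀ x, 0 ≤ h x) ∧
      ∀ x, x ≠ b → 1 + ∑ y, step (gw G) x y * h y ≤ h x := by
  have hn : (1 : ℝ) ≤ Fintype.card V := by
    exact_mod_cast Fintype.card_pos_iff.mpr ⟨b⟩
  set n : ℝ := (Fintype.card V : ℝ) with hndef
  obtain ⟨e, he⟩ : ∃ e : ℝ, e = 1 / (2 * n) := ⟨_, rfl⟩
  have he0 : 0 < e := by rw [he]; positivity
  have he1 : e ≤ 1 := by
    rw [he, div_le_one (by positivity)]; linarith
  have hen : 1 / n = 2 * e := by rw [he]; field_simp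
  obtain ⟨K, hK⟩ : ∃ K : ℝ, K = ∑ x, (e ^ G.dist x b)⁻¹ := ⟨_, rfl⟩
  have hK0 : 0 ≤ K := by rw [hK]; exact Finset.sum_nonneg fun x _ => by positivity
  have hKx : ∀ x, 1 ≤ K * e ^ G.dist x b := by
    intro x
    have : (e ^ G.dist x b)⁻¹ ≤ K := by
      rw [hK]
      exact Finset.single_le_sum (f := fun x => (e ^ G.dist x b)⁻¹)
        (fun i _ => by positivity) (mem_univ x)
    have hp : 0 < e ^ G.dist x b := by positivity
    rwa [inv_le_iff_one_le_mul₀ hp] at this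
  refine ⟨fun x => K * (1 - e ^ G.dist x b), fun x => ?_, fun x hx => ?_⟩
  · exact mul_nonneg hK0 (sub_nonneg.mpr (pow_le_one₀ he0.le he1))
  · obtain ⟨z, hz, hd⟩ := exists_nbr G hconn x b hx
    have hc := condAt_pos G x z hz
    have hs := step_sum G x hc
    have e1 : ∑ y, step (gw G) x y * (K * (1 - e ^ G.dist y b))
        = K - K * ∑ y, step (gw G) x y * e ^ G.dist y b := by
      have hk : K = ∑ y, K * step (gw G) x y := by rw [← Finset.mul_sum, hs, mul_one]
      have h2 : ∑ y, step (gw G) x y * (K * (1 - e ^ G.dist y b))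
          = ∑ y, K * step (gw G) x y - ∑ y, K * (step (gw G) x y * e ^ G.dist y b) := by
        rw [← Finset.sum_sub_distrib]
        exact Finset.sum_congr rfl fun y _ => by ring
      rw [h2, ← hk, Finset.mul_sum]
    have e2 : 2 * e * e ^ G.dist z b ≤ ∑ y, step (gw G) x y * e ^ G.dist y b := by
      refine le_trans ?_ (Finset.single_le_sum
        (f := fun y => step (gw G) x y * e ^ G.dist y b)
        (fun i _ => mul_nonneg (step_nonneg G x i) (by positivity)) (mem_univ z))
      have : 2 * e ≤ step (gw G) x z := by
        rw [← hen]
        unfold step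
        have : gw G x z = 1 := by simp [gw, hz]
        rw [this]
        exact one_div_le_one_div_of_le hc (condAt_le G x)
      exact mul_le_mul_of_nonneg_right this (by positivity)
    have e3 := mul_le_mul_of_nonneg_left e2 hK0
    have e4 := hKx x
    have e5 : 2 * e * e ^ G.dist z b = 2 * e ^ G.dist x b := by rw [hd, pow_succ]; ring
    rw [e5] at e3
    simp only [e1]
    linarith

lemma surv_summable (G : SimpleGraph V) (hconn : G.Connected) (b x : V) :
    Summable fun n => surv (step (gw G)) b n x := by
  obtain ⟨h, h0, hL⟩ := exists_lyap G hconn b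
  exact summable_of_sum_range_le (c := h x) (fun n => surv_nonneg _ (step_nonneg G) b n x)
    (fun n => surv_partial _ (step_nonneg G) b h h0 hL n x)

lemma hit_self (P : V → V → ℝ) (b : V) : hitTime P b b = 0 := by
  unfold hitTime; simp [surv_self]

lemma hit_eq (G : SimpleGraph V) (hconn : G.Connected) (b x : V) (hx : x ≠ b) :
    hitTime (step (gw G)) x b = 1 + ∑ y, step (gw G) x y * hitTime (step (gw G)) y b := by
  unfold hitTime
  rw [(surv_summable G hconn b x).tsum_eq_zero_add]
  simp only [surv, hx, if_false]
  rw [Summable.tsum_finsetSum (fun y _ => (surv_summable G hconn b y).mul_left _)]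
  simp only [tsum_mul_left]

lemma hit_nonneg (G : SimpleGraph V) (b x : V) : 0 ≤ hitTime (step (gw G)) x b :=
  tsum_nonneg fun n => surv_nonneg _ (step_nonneg G) b n x

/-- Laplacian of the hitting time off the target. -/
lemma hit_lap (G : SimpleGraph V) (hconn : G.Connected) (b x : V) (hx : x ≠ b) :
    ∑ y, gw G x y * (hitTime (step (gw G)) x b - hitTime (step (gw G)) y b)
      = condAt (gw G) x := by
  obtain ⟨z, hz, -⟩ := exists_nbr G hconn x b hx
  have hc := condAt_pos G x z hz
  have h := hit_eq G hconn b x hx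
  have h2 : condAt (gw G) x * ∑ y, step (gw G) x y * hitTime (step (gw G)) y b
      = ∑ y, gw G x y * hitTime (step (gw G)) y b := by
    rw [Finset.mul_sum]
    refine Finset.sum_congr rfl fun y _ => ?_
    have : gw G x y = condAt (gw G) x * step (gw G) x y := by
      unfold step; field_simp
    rw [this]; ring
  simp only [mul_sub, Finset.sum_sub_distrib, ← Finset.sum_mul]
  rw [← h2]
  change condAt (gw G) x * _ - _ = _
  linear_combination (condAt (gw G) x) * h

lemma lap_sum_zero (c : V → V → ℝ) (hc : ∀ x y, c x y = c y x) (p : V → ℝ) :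
    ∑ x, ∑ y, c x y * (p x - p y) = 0 := by
  have := lap_pair c hc p (fun _ => 1)
  simp at this
  exact this

lemma hit_lap' (G : SimpleGraph V) (hconn : G.Connected) (b : V) :
    ∑ y, gw G b y * (hitTime (step (gw G)) b b - hitTime (step (gw G)) y b)
      = condAt (gw G) b - ∑ x, condAt (gw G) x := by
  classical
  have h := lap_sum_zero (gw G) (gw_symm G) (fun x => hitTime (step (gw G)) x b)
  rw [← Finset.add_sum_erase _ _ (mem_univ b)] at h
  rw [← Finset.add_sum_erase univ (condAt (gw G)) (mem_univ b)]
  have h2 : ∑ x ∈ univ.erase b,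
      ∑ y, gw G x y * (hitTime (step (gw G)) x b - hitTime (step (gw G)) y b)
      = ∑ x ∈ univ.erase b, condAt (gw G) x :=
    Finset.sum_congr rfl fun x hx => hit_lap G hconn b x (Finset.ne_of_mem_erase hx)
  rw [h2] at h
  linarith

lemma sum_condAt (G : SimpleGraph V) : ∑ x, condAt (gw G) x = 2 * (numEdges G : ℝ) := by
  classical
  have h1 : ∀ x, condAt (gw G) x = (G.degree x : ℝ) := by
    intro x
    unfold condAt gw
    rw [Finset.sum_boole, ← SimpleGraph.card_neighborFinset_eq_degree]
    congr 2
    ext y; simp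
  simp only [h1]
  have h2 : numEdges G = #G.edgeFinset := by
    unfold numEdges
    rw [← SimpleGraph.coe_edgeFinset, Set.ncard_coe_finset]
  rw [h2]
  exact_mod_cast G.sum_degrees_eq_twice_card_edges

end Aux

/-- Commute time identity of Chandra et al.:
`E_a T_b + E_b T_a = 2 |E| R_{ab}`. -/
theorem commute_time_identity {V : Type*} [Fintype V] (G : SimpleGraph V)
    (hconn : G.Connected) (a b : V) :
    hitTime (step (gw G)) a b + hitTime (step (gw G)) b a
      = 2 * (numEdges G : ℝ) * effRes (gw G) a b := by
  classical
  by_cases hab : a = b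
  · subst hab
    have : {E : ℝ | ∃ f : V → ℝ, f a = 1 ∧ f a = 0 ∧ E = energy (gw G) f} = ∅ := by
      ext E
      simp only [Set.mem_ofPred_eq, Set.mem_empty_iff_false, iff_false]
      rintro ⟨f, h1, h0, -⟩
      rw [h1] at h0; norm_num at h0
    unfold effRes
    rw [this]
    simp [hit_self]
  obtain ⟨M, hM⟩ : ∃ M : ℝ, M = 2 * (numEdges G : ℝ) := ⟨_, rfl⟩
  have hMs := sum_condAt G
  rw [← hM] at hMs ⊢
  have hMpos : 0 < M := by
    rw [← hMs]
    obtain ⟨z, hz, -⟩ := exists_nbr G hconn a b hab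
    refine lt_of_lt_of_le (condAt_pos G a z hz)
      (Finset.single_le_sum (f := fun y => condAt (gw G) y) (fun i _ => ?_) (mem_univ a))
    exact Finset.sum_nonneg fun j _ => gw_nonneg G i j
  obtain ⟨C, hC⟩ : ∃ C : ℝ,
    C = hitTime (step (gw G)) a b + hitTime (step (gw G)) b a := ⟨_, rfl⟩
  have hCpos : 0 < C := by
    have h1 := hit_eq G hconn b a hab
    have h2 : 0 ≤ ∑ y, step (gw G) a y * hitTime (step (gw G)) y b :=
      Finset.sum_nonneg fun y _ => mul_nonneg (step_nonneg G a y) (hit_nonneg G b y)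
    have h3 := hit_nonneg G a b
    linarith
  rw [← hC]
  obtain ⟨g, hg⟩ : ∃ g : V → ℝ, g = fun x => (hitTime (step (gw G)) x b
    - hitTime (step (gw G)) x a + hitTime (step (gw G)) b a) / C := ⟨_, rfl⟩
  have hga : g a = 1 := by
    simp only [hg, hit_self]
    rw [sub_zero, ← hC]; exact div_self hCpos.ne'
  have hgb : g b = 0 := by simp [hg, hit_self]
  have hlap : ∀ x, ∑ y, gw G x y * (g x - g y)
      = M / C * ((if x = a then 1 else 0) - (if x = b then 1 else 0)) := by
    intro x
    have e1 : ∑ y, gw G x y * (g x - g y)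
        = (∑ y, gw G x y * (hitTime (step (gw G)) x b - hitTime (step (gw G)) y b)
          - ∑ y, gw G x y * (hitTime (step (gw G)) x a - hitTime (step (gw G)) y a)) / C := by
      rw [← Finset.sum_sub_distrib, Finset.sum_div]
      refine Finset.sum_congr rfl fun y _ => ?_
      simp only [hg]; ring
    rw [e1]
    by_cases hxa : x = a
    · subst hxa
      rw [hit_lap G hconn b x hab, hit_lap' G hconn x, hMs]
      simp [hab]
    · by_cases hxb : x = b
      · subst hxb
        rw [hit_lap G hconn a x hxa, hit_lap' G hconn x, hMs]
        simp [hxa]; ring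
      · rw [hit_lap G hconn a x hxa, hit_lap G hconn b x hxb]
        simp [hxa, hxb]
  have hpair : ∀ f : V → ℝ, ∑ x, f x * ∑ y, gw G x y * (g x - g y) = M / C * (f a - f b) := by
    intro f
    simp only [hlap]
    have : ∀ x, f x * (M / C * ((if x = a then 1 else 0) - (if x = b then 1 else 0)))
        = (if x = a then M / C * f x else 0) - (if x = b then M / C * f x else 0) := by
      intro x; split_ifs <;> ring
    simp only [this, Finset.sum_sub_distrib]
    simp
    ring
  have hmin : IsLeast {E : ℝ | ∃ f : V → ℝ, f a = 1 ∧ f b = 0 ∧ E = energy (gw G) f}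
      (M / C) := by
    have heg : energy (gw G) g = M / C := by
      rw [energy_eq _ (gw_symm G), hpair, hga, hgb]; ring
    refine ⟨⟨g, hga, hgb, heg.symm⟩, ?_⟩
    rintro E ⟨f, hfa, hfb, rfl⟩
    have h := energy_add (gw G) (gw_symm G) g (fun x => f x - g x)
    rw [hpair, heg, hfa, hfb, hga, hgb] at h
    have h2 := energy_nonneg' (gw G) (gw_nonneg G) (fun x => f x - g x)
    have h3 : (fun x => g x + (f x - g x)) = f := by funext x; ring
    rw [h3] at h
    linarith
  unfold effRes
  rw [hmin.csInf_eq]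
  field_simp
end

section
/- Let G be a walk-regular graph. Then for any two vertices a, b, the expected hitting times of simple random walk satisfy E_a T_b = E_b T_a, and consequently E_a T_b = |E| R_{ab}, where |E| is the number of edges and R_{ab} the effective resistance between a and b with unit edge resistances. -/
open Finset

open Matrix Polynomial in
lemma wr_pinv {V : Type*} [Fintype V] [DecidableEq V] (L : Matrix V V ℝ) (hL : Lᵀ = L) :
    ∃ r : ℝ[X], L * aeval L r * L = L := by
  have key : ∀ (k : ℕ) (Z : Matrix V V ℝ), L ^ k * Z = 0 → L * Z = 0 := by
    intro k
    induction k with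
    | zero => intro Z h; simp at h; simp [h]
    | succ k ih =>
      intro Z h
      rw [pow_succ, mul_assoc] at h
      have h2 := ih _ h
      have h3 := Matrix.conjTranspose_mul_self_mul_eq_zero L Z
      rw [conjTranspose_eq_transpose_of_trivial, hL, mul_assoc] at h3
      exact h3.1 h2
  have hne : minpoly ℝ L ≠ 0 := minpoly.ne_zero (Matrix.isIntegral L)
  obtain ⟨q, hq, hdvd⟩ := (minpoly ℝ L).exists_eq_pow_rootMultiplicity_mul_and_not_dvd hne 0
  rw [map_zero, sub_zero] at hq hdvd
  have h0 := minpoly.aeval ℝ L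
  rw [hq, map_mul, map_pow, aeval_X] at h0
  have h1 := key _ _ h0
  have hq0 : q.coeff 0 ≠ 0 := fun h => hdvd (X_dvd_iff.2 h)
  have h2 := congrArg (aeval L) (divX_mul_X_add q)
  rw [map_add, map_mul, aeval_X, aeval_C] at h2
  rw [← h2, mul_add, ← mul_assoc, Algebra.algebraMap_eq_smul_one, mul_smul_comm, mul_one] at h1
  refine ⟨C (-(q.coeff 0)⁻¹) * q.divX, ?_⟩
  rw [map_mul, aeval_C, Algebra.algebraMap_eq_smul_one, smul_mul_assoc, one_mul, mul_smul_comm,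
    smul_mul_assoc, eq_neg_of_add_eq_zero_left h1, smul_neg, neg_smul, neg_neg, smul_smul,
    inv_mul_cancel₀ hq0, one_smul]

open Matrix Polynomial in
lemma wr_green {V : Type*} [Fintype V] [DecidableEq V]
    (G : SimpleGraph V) [DecidableRel G.Adj] (hconn : G.Connected)
    (hwr : ∀ (k : ℕ) (x y : V),
      ((G.adjMatrix ℝ) ^ k) x x = ((G.adjMatrix ℝ) ^ k) y y)
    (d : ℕ) (hd : ∀ x, G.degree x = d) :
    ∃ M : Matrix V V ℝ, (∀ x y, M x y = M y x) ∧ (∀ x y, M x x = M y y) ∧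
      ∀ x y, (G.lapMatrix ℝ * M) x y = (if x = y then 1 else 0) - 1 / (Fintype.card V : ℝ) := by
  have hLs : (G.lapMatrix ℝ)ᵀ = G.lapMatrix ℝ := G.isSymm_lapMatrix (R := ℝ)
  obtain ⟨r, hr⟩ := wr_pinv (G.lapMatrix ℝ) hLs
  set L := G.lapMatrix ℝ with hL
  have hLA : L = aeval (G.adjMatrix ℝ) (C (d : ℝ) - X) := by
    rw [map_sub, aeval_X, aeval_C, hL, SimpleGraph.lapMatrix]
    congr 1
    ext i j
    simp [SimpleGraph.degMatrix, hd, Matrix.algebraMap_matrix_apply, Matrix.diagonal_apply]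
  have hsym : (aeval L r)ᵀ = aeval L r := by
    rw [aeval_eq_sum_range, Matrix.transpose_sum]
    simp [Matrix.transpose_pow, hLs]
  have hdiag : ∀ (p : ℝ[X]) x y, aeval (G.adjMatrix ℝ) p x x = aeval (G.adjMatrix ℝ) p y y := by
    intro p x y
    rw [aeval_eq_sum_range, Matrix.sum_apply, Matrix.sum_apply]
    simp [hwr _ x y]
  have hcomm : L * aeval L r = aeval L r * L := by
    have : aeval L (X * r) = aeval L (r * X) := by rw [mul_comm]
    simpa using this
  refine ⟨aeval L r, fun x y => ?_, fun x y => ?_, ?_⟩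
  · conv_lhs => rw [← hsym]
    rfl
  · rw [hLA, ← aeval_comp]
    exact hdiag _ _ _
  · set M := aeval L r
    set N := 1 - L * M with hN
    have hLN : L * N = 0 := by
      rw [hN, hcomm, mul_sub, mul_one, ← mul_assoc, hr, sub_self]
    have hNs : Nᵀ = N := by
      rw [hN, transpose_sub, transpose_one, transpose_mul, hLs, hsym, hcomm]
    have hcol : ∀ i j y, N i y = N j y := by
      intro i j y
      have h1 : L *ᵥ (fun i => N i y) = 0 := by
        ext i
        exact congrFun (congrFun hLN i) y
      exact (G.lapMatrix_mulVec_eq_zero_iff_forall_reachable.1 h1) i j (hconn.preconnected i j)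
    have hrow : ∀ x i j, N x i = N x j := by
      intro x i j
      rw [← hNs]
      exact hcol i j x
    have hone : ∀ y, ∑ x, L x y = 0 := by
      intro y
      have := congrFun (G.lapMatrix_mulVec_const_eq_zero (R := ℝ)) y
      simp only [mulVec, dotProduct, mul_one] at this
      rw [← hL] at this
      rw [← hLs]
      exact this
    have hsum : ∀ y, ∑ x, N x y = 1 := by
      intro y
      simp only [hN, Matrix.sub_apply, Finset.sum_sub_distrib, Matrix.mul_apply]
      rw [Finset.sum_comm]
      simp only [← Finset.sum_mul, hone, zero_mul]
      simp [Matrix.one_apply]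
    intro x y
    have hNv : N x y = 1 / (Fintype.card V : ℝ) := by
      have h1 := hsum y
      rw [Finset.sum_congr rfl (fun i _ => hcol i x y)] at h1
      simp only [Finset.sum_const, Finset.card_univ, nsmul_eq_mul] at h1
      exact eq_one_div_of_mul_eq_one_right h1
    have h3 : (L * M) x y = (1 : Matrix V V ℝ) x y - N x y := by simp [hN]
    rw [h3, hNv, Matrix.one_apply]

lemma wr_surv_nonneg {V : Type*} [Fintype V] (P : V → V → ℝ) (hP : ∀ x y, 0 ≤ P x y) (b : V) :
    ∀ n a, 0 ≤ surv P b n a := by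
  intro n
  induction n with
  | zero => intro a; simp only [surv]; split_ifs <;> norm_num
  | succ n ih =>
    intro a
    simp only [surv]
    split_ifs
    · exact le_rfl
    · exact Finset.sum_nonneg fun y _ => mul_nonneg (hP _ _) (ih y)

lemma wr_surv_self {V : Type*} [Fintype V] (P : V → V → ℝ) (b : V) (n : ℕ) :
    surv P b n b = 0 := by
  cases n <;> simp [surv]

lemma wr_summable {V : Type*} [Fintype V] (P : V → V → ℝ) (hP : ∀ x y, 0 ≤ P x y) (b : V)
    (h : V → ℝ) (h0 : ∀ x, 0 ≤ h x) (hs : ∀ x, x ≠ b → 1 + ∑ y, P x y * h y ≤ h x) (a : V) :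
    Summable (fun n => surv P b n a) := by
  have key : ∀ n x, ∑ k ∈ Finset.range n, surv P b k x ≤ h x := by
    intro n
    induction n with
    | zero => intro x; simpa using h0 x
    | succ n ih =>
      intro x
      by_cases hx : x = b
      · subst hx
        simp [wr_surv_self, h0]
      · rw [Finset.sum_range_succ']
        simp only [surv, if_neg hx]
        rw [Finset.sum_comm]
        simp only [← Finset.mul_sum]
        refine le_trans ?_ (hs x hx)
        rw [add_comm]
        gcongr with y
        · exact hP x y
        · exact ih y
  exact summable_of_sum_range_le (fun n => wr_surv_nonneg P hP b n a) (fun n => key n a)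

lemma wr_hit_rec {V : Type*} [Fintype V] (P : V → V → ℝ) (b : V)
    (hS : ∀ a, Summable (fun n => surv P b n a)) (a : V) (hab : a ≠ b) :
    hitTime P a b = 1 + ∑ y, P a y * hitTime P y b := by
  unfold hitTime
  rw [(hS a).tsum_eq_zero_add]
  simp only [surv, if_neg hab]
  rw [Summable.tsum_finsetSum (fun y _ => (hS y).mul_left _)]
  simp only [tsum_mul_left]

open Matrix in
lemma wr_energy {V : Type*} [Fintype V] [DecidableEq V]
    (G : SimpleGraph V) [DecidableRel G.Adj] (f : V → ℝ) :
    energy (gw G) f = f ⬝ᵥ (G.lapMatrix ℝ *ᵥ f) := by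
  rw [← Matrix.toLinearMap₂'_apply', SimpleGraph.lapMatrix_toLinearMap₂']
  unfold energy gw
  rw [one_div, inv_mul_eq_div]
  congr 1
  refine Finset.sum_congr rfl fun x _ => Finset.sum_congr rfl fun y _ => ?_
  by_cases h : G.Adj x y <;> simp [h]

open Matrix in
lemma wr_effRes {V : Type*} [Fintype V] [DecidableEq V]
    (G : SimpleGraph V) [DecidableRel G.Adj] (a b : V) (g : V → ℝ) (c R : ℝ) (hR : R ≠ 0)
    (hg : G.lapMatrix ℝ *ᵥ g = fun x => c * ((if x = a then 1 else 0) - (if x = b then 1 else 0)))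
    (hgR : g a - g b = R) :
    effRes (gw G) a b = R / c := by
  set L := G.lapMatrix ℝ with hL
  have hLs : Lᵀ = L := G.isSymm_lapMatrix (R := ℝ)
  set φ : V → ℝ := R⁻¹ • (g - Function.const V (g b)) with hφ
  have hdot : ∀ f : V → ℝ, f ⬝ᵥ (L *ᵥ φ) = R⁻¹ * c * (f a - f b) := by
    intro f
    have h0 : L *ᵥ Function.const V (g b) = 0 := by
      rw [hL, G.lapMatrix_mulVec_eq_zero_iff_forall_reachable]
      intros; rfl
    rw [hφ, mulVec_smul, mulVec_sub, h0, sub_zero, hg, dotProduct_smul, smul_eq_mul, mul_assoc]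
    congr 1
    simp only [dotProduct, mul_sub, Finset.sum_sub_distrib]
    simp [mul_comm]
  have ha : φ a = 1 := by simp [hφ, hgR, hR]
  have hb : φ b = 0 := by simp [hφ]
  have hE : energy (gw G) φ = c / R := by
    rw [wr_energy, hdot, ha, hb]; ring
  have hleast : IsLeast {E : ℝ | ∃ f : V → ℝ, f a = 1 ∧ f b = 0 ∧ E = energy (gw G) f} (c / R) := by
    refine ⟨⟨φ, ha, hb, hE.symm⟩, ?_⟩
    rintro E ⟨f, hfa, hfb, rfl⟩
    have hpos : 0 ≤ (f - φ) ⬝ᵥ (L *ᵥ (f - φ)) := by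
      rw [← wr_energy]
      unfold energy gw
      refine mul_nonneg (by norm_num) (Finset.sum_nonneg fun x _ => Finset.sum_nonneg fun y _ => ?_)
      split_ifs <;> positivity
    have hcomm : φ ⬝ᵥ (L *ᵥ f) = f ⬝ᵥ (L *ᵥ φ) := by
      rw [dotProduct_mulVec, ← mulVec_transpose, hLs, dotProduct_comm]
    rw [mulVec_sub, sub_dotProduct, dotProduct_sub, dotProduct_sub, hcomm, hdot, hdot, hfa, hfb,
      ha, hb, ← wr_energy] at hpos
    have : c / R = R⁻¹ * c := by ring
    linarith
  rw [effRes, hleast.csInf_eq, one_div_div]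

open Matrix in
lemma wr_hit {V : Type*} [Fintype V] [DecidableEq V]
    (G : SimpleGraph V) [DecidableRel G.Adj] (hconn : G.Connected)
    (d : ℕ) (hd : ∀ x, G.degree x = d) (hd0 : 0 < d) (b : V) (h : V → ℝ) (hb : h b = 0)
    (hh : ∀ x, (G.lapMatrix ℝ *ᵥ h) x = d * (1 - if x = b then (Fintype.card V : ℝ) else 0)) :
    (∀ x, hitTime (step (gw G)) x b = h x) ∧ ∀ x, x ≠ b → 1 ≤ h x := by
  have hdR : (0 : ℝ) < d := by exact_mod_cast hd0
  set P := step (gw G) with hPdef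
  have hcond : ∀ x, condAt (gw G) x = d := by
    intro x
    rw [← hd x, SimpleGraph.degree_eq_sum_if_adj]
    unfold condAt gw
    refine Finset.sum_congr rfl fun y _ => ?_
    by_cases h : G.Adj x y <;> simp [h]
  have hP : ∀ x y, 0 ≤ P x y := by
    intro x y
    rw [hPdef, step, hcond, gw]
    split_ifs <;> positivity
  have hPL : ∀ (f : V → ℝ) x, (G.lapMatrix ℝ *ᵥ f) x = d * (f x - ∑ y, P x y * f y) := by
    intro f x
    rw [SimpleGraph.lapMatrix_mulVec_apply, hd, mul_sub, Finset.mul_sum]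
    congr 1
    rw [SimpleGraph.neighborFinset_eq_filter, Finset.sum_filter]
    refine Finset.sum_congr rfl fun y _ => ?_
    rw [hPdef, step, hcond, gw]
    by_cases h : G.Adj x y <;> simp [h]
    field_simp
  have hP1 : ∀ x, ∑ y, P x y = 1 := by
    intro x
    simp only [hPdef, step, ← Finset.sum_div]
    rw [hcond, ← hcond x]
    have h1 : condAt (gw G) x ≠ 0 := by rw [hcond]; exact hdR.ne'
    exact div_self h1
  have hrec : ∀ x, x ≠ b → h x = 1 + ∑ y, P x y * h y := by
    intro x hx
    have h1 := hh x
    rw [hPL, if_neg hx, sub_zero] at h1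
    have := mul_left_cancel₀ hdR.ne' h1
    linarith
  have hnn : ∀ x, 0 ≤ h x := by
    have : Nonempty V := ⟨b⟩
    obtain ⟨z, hz⟩ := Finite.exists_min h
    by_cases hzb : z = b
    · intro x; rw [← hb, ← hzb]; exact hz x
    · exfalso
      have h1 := hrec z hzb
      have h2 : ∑ y, P z y * h z ≤ ∑ y, P z y * h y :=
        Finset.sum_le_sum fun y _ => mul_le_mul_of_nonneg_left (hz y) (hP z y)
      rw [← Finset.sum_mul, hP1] at h2
      linarith
  have hS := wr_summable P hP b h hnn (fun x hx => (hrec x hx).ge)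
  have hr := wr_hit_rec P b hS
  have hbb : hitTime P b b = 0 := by simp [hitTime, wr_surv_self]
  refine ⟨?_, fun x hx => ?_⟩
  · set D : V → ℝ := fun x => hitTime P x b - h x with hD
    have hDoff : ∀ x, x ≠ b → (G.lapMatrix ℝ *ᵥ D) x = 0 := by
      intro x hx
      rw [hPL]
      simp only [hD, mul_sub, Finset.sum_sub_distrib]
      rw [hr x hx, hrec x hx]
      ring
    have hDb : D b = 0 := by simp [hD, hbb, hb]
    have hE : D ⬝ᵥ (G.lapMatrix ℝ *ᵥ D) = 0 := by
      refine Finset.sum_eq_zero fun x _ => ?_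
      by_cases hx : x = b
      · rw [hx, hDb, zero_mul]
      · rw [hDoff x hx, mul_zero]
    rw [← Matrix.toLinearMap₂'_apply',
      SimpleGraph.lapMatrix_toLinearMap₂'_apply'_eq_zero_iff_forall_reachable] at hE
    intro x
    have := hE x b (hconn.preconnected x b)
    rw [hDb] at this
    exact sub_eq_zero.1 this
  · rw [hrec x hx]
    have : 0 ≤ ∑ y, P x y * h y := Finset.sum_nonneg fun y _ => mul_nonneg (hP x y) (hnn y)
    linarith

open Matrix in
/-- On a walk-regular graph, hitting times are symmetric and
`E_a T_b = |E| R_{ab}`. -/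
theorem walk_regular_hitting {V : Type*} [Fintype V] [DecidableEq V]
    (G : SimpleGraph V) [DecidableRel G.Adj] (hconn : G.Connected)
    (hwr : ∀ (k : ℕ) (x y : V),
      ((G.adjMatrix ℝ) ^ k) x x = ((G.adjMatrix ℝ) ^ k) y y)
    (a b : V) :
    hitTime (step (gw G)) a b = hitTime (step (gw G)) b a ∧
      hitTime (step (gw G)) a b = (numEdges G : ℝ) * effRes (gw G) a b := by
  by_cases hab : a = b
  · subst hab
    refine ⟨rfl, ?_⟩
    have h1 : {E : ℝ | ∃ f : V → ℝ, f a = 1 ∧ f a = 0 ∧ E = energy (gw G) f} = ∅ := by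
      ext E
      simp only [Set.mem_ofPred_eq, Set.mem_empty_iff_false, iff_false]
      rintro ⟨f, h1, h2, -⟩
      rw [h1] at h2
      exact one_ne_zero h2
    rw [effRes, h1]
    simp [hitTime, wr_surv_self]
  obtain ⟨d, hd⟩ : ∃ d, ∀ x, G.degree x = d := by
    refine ⟨G.degree a, fun x => ?_⟩
    have := hwr 2 x a
    rw [pow_two, SimpleGraph.adjMatrix_mul_self_apply_self,
      SimpleGraph.adjMatrix_mul_self_apply_self] at this
    exact_mod_cast this
  have hd0 : 0 < d := by
    have : Nontrivial V := ⟨a, b, hab⟩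
    rw [← hd a]
    exact hconn.preconnected.degree_pos_of_nontrivial a
  have hdR : (d : ℝ) ≠ 0 := by exact_mod_cast hd0.ne'
  have hn : (Fintype.card V : ℝ) ≠ 0 := by
    have : Nonempty V := ⟨a⟩
    exact_mod_cast Fintype.card_ne_zero
  obtain ⟨M, hMs, hMd, hLM⟩ := wr_green G hconn hwr d hd
  set n : ℝ := (Fintype.card V : ℝ) with hndef
  have hKL : ∀ z x, (G.lapMatrix ℝ *ᵥ (fun x => d * n * (M z z - M x z))) x =
      d * (1 - if x = z then n else 0) := by
    intro z x
    have h0 : G.lapMatrix ℝ *ᵥ Function.const V (M z z) = 0 := by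
      rw [G.lapMatrix_mulVec_eq_zero_iff_forall_reachable]
      intros; rfl
    have h1 : (fun x => d * n * (M z z - M x z)) =
        ((d : ℝ) * n) • (Function.const V (M z z) - fun x => M x z) := by
      ext x; simp
    have h2 : (G.lapMatrix ℝ *ᵥ fun x => M x z) x = (G.lapMatrix ℝ * M) x z := rfl
    rw [h1, mulVec_smul, mulVec_sub, h0, zero_sub, Pi.smul_apply, Pi.neg_apply, h2, hLM,
      smul_eq_mul]
    split_ifs <;> field_simp <;> ring
  obtain ⟨hHb, hHb1⟩ := wr_hit G hconn d hd hd0 b _ (by simp) (hKL b)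
  obtain ⟨hHa, -⟩ := wr_hit G hconn d hd hd0 a _ (by simp) (hKL a)
  have hsymm : d * n * (M b b - M a b) = d * n * (M a a - M b a) := by
    rw [hMs a b, hMd a b]
  have h1 := hHb1 a hab
  refine ⟨by rw [hHb, hHa, hsymm], ?_⟩
  rw [hHb]
  set H := d * n * (M b b - M a b) with hH
  have hEd : (numEdges G : ℝ) = d * n / 2 := by
    have h2 := G.sum_degrees_eq_twice_card_edges
    simp only [hd, Finset.sum_const, Finset.card_univ, smul_eq_mul] at h2
    have h3 : numEdges G = G.edgeFinset.card := by
      rw [numEdges, ← SimpleGraph.coe_edgeFinset, Set.ncard_coe_finset]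
    rw [h3, hndef]
    have h4 : (Fintype.card V : ℝ) * d = 2 * G.edgeFinset.card := by exact_mod_cast h2
    linarith
  have hres := wr_effRes G a b
    ((fun x => d * n * (M b b - M x b)) - (fun x => d * n * (M a a - M x a))) (d * n) (2 * H)
    (by positivity)
    (by
      ext x
      rw [mulVec_sub, Pi.sub_apply, hKL, hKL]
      split_ifs <;> ring)
    (by
      simp only [Pi.sub_apply]
      rw [← hH, ← hsymm]
      ring)
  rw [hres, hEd]
  field_simp
end
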